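/- Let F : S¹ → ℂ be continuous with Fourier coefficients c_m(F) := (1/2π)∫_0^{2π} e^{−imx} F(e^{ix}) dx, assume c_0(F) = 0, and let ϑ ≥ 0. If there exists s > (1−ϑ)_+ := max{1−ϑ, 0} such that Σ_{m∈ℤ} |m|^s·|c_m(F)| < ∞, then Σ_{k=1}^∞ k^{(1−ϑ)_+}·sup_{x∈[0,2π)} |Δ_k(F, e^{ix})| < ∞; in particular, for any sequence (Z_k)_{k≥1} of S¹-valued random variables, Σ_{k=1}^∞ k^{(1−ϑ)_+}·𝔼[|Δ_k(F,Z_k)|] < ∞. -/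

import Mathlib

open scoped BigOperators
open Filter Asymptotics MeasureTheory

/-- `Δ_k(F,y) = (1/k) ∑_{ω^k = y} F(ω)`, the average of `F` over the `k`-th roots of
`y ≠ 0`, parameterized as `exp((log y + 2πim)/k)` for `m = 0,…,k−1`. -/
noncomputable def Δroot (F : ℂ → ℂ) (k : ℕ) (y : ℂ) : ℂ :=
  (k : ℂ)⁻¹ * ∑ m ∈ Finset.range k,
    F (Complex.exp ((Complex.log y + 2 * Real.pi * Complex.I * m) / k))

/-- The `m`-th Fourier coefficient `c_m(F) = (1/2π)∫_0^{2π} e^{−imx} F(e^{ix}) dx`. -/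
noncomputable def fourierCoeffF (F : ℂ → ℂ) (m : ℤ) : ℂ :=
  (2 * Real.pi : ℂ)⁻¹ *
    ∫ x in (0 : ℝ)..(2 * Real.pi),
      Complex.exp (-Complex.I * m * x) * F (Complex.exp (Complex.I * x))

/-- The divisor bound: `d(n) = O(n ^ ε)` for every `ε > 0`. -/
theorem exists_card_divisors_le_mul_rpow {ε : ℝ} (hε : 0 < ε) :
    ∃ C : ℝ, 0 ≤ C ∧ ∀ n : ℕ, n ≠ 0 → (n.divisors.card : ℝ) ≤ C * (n : ℝ) ^ ε := by
  set K : ℝ := max 1 (1 / (ε * Real.log 2)) with hK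
  set N : ℕ := ⌈Real.exp (1 / ε)⌉₊ with hN
  have hlog2 : 0 < Real.log 2 := Real.log_pos one_lt_two
  have hK1 : 1 ≤ K := le_max_left _ _
  have hK2 : 1 ≤ K * (ε * Real.log 2) := by
    have h : 1 / (ε * Real.log 2) ≤ K := le_max_right _ _
    rwa [div_le_iff₀ (by positivity)] at h
  refine ⟨K ^ N, by positivity, fun n hn => ?_⟩
  have local_bound : ∀ p ∈ n.primeFactors, ((n.factorization p + 1 : ℕ) : ℝ) ≤
      (if p < N then K else 1) * ((p : ℝ) ^ n.factorization p) ^ ε := by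
    intro p hp
    have hp2 : (2 : ℝ) ≤ p := by exact_mod_cast (Nat.prime_of_mem_primeFactors hp).two_le
    have hp0 : (0 : ℝ) < p := by linarith
    set v := n.factorization p
    have hlog : Real.log 2 ≤ Real.log p := Real.log_le_log two_pos hp2
    have hexp : (v : ℝ) * (ε * Real.log p) + 1 ≤ ((p : ℝ) ^ v) ^ ε := by
      rw [Real.rpow_def_of_pos (by positivity), Real.log_pow]
      convert Real.add_one_le_exp _ using 2
      ring
    push_cast
    split_ifs with h
    · calc (v : ℝ) + 1 ≤ v * (K * (ε * Real.log p)) + K := by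
            have : 1 ≤ K * (ε * Real.log p) := hK2.trans (by gcongr)
            nlinarith [(Nat.cast_nonneg v : (0 : ℝ) ≤ v)]
        _ = K * (v * (ε * Real.log p) + 1) := by ring
        _ ≤ _ := by gcongr
    · have h1 : Real.exp (1 / ε) ≤ p := (Nat.le_ceil _).trans (by exact_mod_cast not_lt.mp h)
      have h2 : 1 / ε ≤ Real.log p := (Real.le_log_iff_exp_le hp0).mpr h1
      rw [div_le_iff₀ hε] at h2
      nlinarith [(Nat.cast_nonneg v : (0 : ℝ) ≤ v)]
  rw [Nat.card_divisors hn, Nat.cast_prod]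
  calc ∏ p ∈ n.primeFactors, ((n.factorization p + 1 : ℕ) : ℝ)
      ≤ ∏ p ∈ n.primeFactors, (if p < N then K else 1) * ((p : ℝ) ^ n.factorization p) ^ ε :=
        Finset.prod_le_prod (fun _ _ => by positivity) local_bound
    _ = K ^ (n.primeFactors.filter (· < N)).card * (n : ℝ) ^ ε := by
        rw [Finset.prod_mul_distrib, ← Finset.prod_filter, Finset.prod_const,
          Real.finsetProd_rpow _ _ (fun _ _ => by positivity)]
        congr 2
        exact_mod_cast Nat.prod_factorization_pow_eq_self hn
    _ ≤ K ^ N * (n : ℝ) ^ ε := by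
        gcongr
        calc _ ≤ (Finset.range N).card :=
            Finset.card_le_card fun p hp => by simpa using (Finset.mem_filter.mp hp).2
          _ = N := Finset.card_range N

theorem summable_norm_fourierCoeffF {F : ℂ → ℂ} {s : ℝ} (hs : 0 ≤ s)
    (hsum : Summable fun m : ℤ => |(m : ℝ)| ^ s * ‖fourierCoeffF F m‖) :
    Summable fun m : ℤ => ‖fourierCoeffF F m‖ := by
  refine Summable.of_norm_bounded_eventually hsum ?_
  filter_upwards [(Set.finite_singleton (0 : ℤ)).compl_mem_cofinite] with m hm
  rw [norm_norm]
  refine le_mul_of_one_le_left (norm_nonneg _) (Real.one_le_rpow ?_ hs)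
  exact_mod_cast Int.one_le_abs hm

/-- A continuous function on the circle is the sum of its Fourier series as soon as the Fourier
coefficients are absolutely summable. -/
theorem hasSum_fourierCoeffF {F : ℂ → ℂ} (hF : ContinuousOn F (Metric.sphere (0 : ℂ) 1))
    (hsum : Summable fun m : ℤ => ‖fourierCoeffF F m‖) (t : ℝ) :
    HasSum (fun m : ℤ => fourierCoeffF F m * Complex.exp (Complex.I * m * t))
      (F (Complex.exp (Complex.I * t))) := by
  have : Fact (0 < 2 * Real.pi) := ⟨Real.two_pi_pos⟩
  let f : C(AddCircle (2 * Real.pi), ℂ) :=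
    ⟨fun x => F (AddCircle.toCircle x), hF.comp_continuous
      (continuous_subtype_val.comp AddCircle.continuous_toCircle) (fun x => (AddCircle.toCircle x).2)⟩
  have hπ : (Real.pi : ℂ) ≠ 0 := by exact_mod_cast Real.pi_ne_zero
  have hf : ∀ x : ℝ, f x = F (Complex.exp (Complex.I * x)) := by
    intro x
    change F (AddCircle.toCircle (x : AddCircle (2 * Real.pi))) = _
    rw [AddCircle.toCircle_apply_mk, Circle.coe_exp, div_self Real.two_pi_pos.ne', one_mul,
      mul_comm]
  have hcoeff : ∀ m : ℤ, fourierCoeff f m = fourierCoeffF F m := by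
    intro m
    rw [fourierCoeff_eq_intervalIntegral _ _ 0, fourierCoeffF, zero_add, Complex.real_smul]
    congr 1
    · push_cast; rw [one_div]
    · refine intervalIntegral.integral_congr fun x _ => ?_
      simp only [hf, fourier_coe_apply, smul_eq_mul]
      congr 2
      push_cast
      field_simp
  have h := has_pointwise_sum_fourier_series_of_summable (f := f)
    (Summable.of_norm (by simpa only [hcoeff] using hsum)) (t : AddCircle (2 * Real.pi))
  rw [hf] at h
  convert h using 2 with m
  rw [hcoeff, fourier_coe_apply, smul_eq_mul]
  congr 2
  push_cast
  field_simp

theorem sum_range_exp_eq_zero_of_not_dvd {k : ℕ} (hk : k ≠ 0) {m : ℤ} (hm : ¬ (k : ℤ) ∣ m) :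
    ∑ j ∈ Finset.range k, Complex.exp (2 * Real.pi * Complex.I * m * j / k) = 0 := by
  have hζ := Complex.isPrimitiveRoot_exp k hk
  set ζ := Complex.exp (2 * Real.pi * Complex.I / k) with hζdef
  have h1 : ∀ j : ℕ, Complex.exp (2 * Real.pi * Complex.I * m * j / k) = (ζ ^ m) ^ j := by
    intro j
    rw [hζdef, ← Complex.exp_int_mul, ← Complex.exp_nat_mul]
    congr 1
    ring
  have hne : ζ ^ m ≠ 1 := fun h => hm ((hζ.zpow_eq_one_iff_dvd m).mp h)
  simp_rw [h1]
  rw [geom_sum_eq hne, ← zpow_natCast, ← zpow_mul, mul_comm, zpow_mul, zpow_natCast, hζ.pow_eq_one,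
    one_zpow, sub_self, zero_div]

theorem norm_Δroot_le {F : ℂ → ℂ} (hF : ContinuousOn F (Metric.sphere (0 : ℂ) 1))
    (hsum : Summable fun m : ℤ => ‖fourierCoeffF F m‖) {k : ℕ} (hk : k ≠ 0) {y : ℂ}
    (hy : y ∈ Metric.sphere (0 : ℂ) 1) :
    ‖Δroot F k y‖ ≤ ∑' m : ℤ, if (k : ℤ) ∣ m then ‖fourierCoeffF F m‖ else 0 := by
  have hk' : (k : ℂ) ≠ 0 := by exact_mod_cast hk
  have hlog : Complex.log y = Complex.I * (y.arg : ℝ) := by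
    rw [mem_sphere_zero_iff_norm] at hy
    rw [Complex.log, hy, Real.log_one, Complex.ofReal_zero, zero_add, mul_comm]
  have hpt : ∀ j : ℕ, Complex.exp ((Complex.log y + 2 * Real.pi * Complex.I * j) / k) =
      Complex.exp (Complex.I * ((y.arg + 2 * Real.pi * j) / k : ℝ)) := by
    intro j
    rw [hlog]
    congr 1
    push_cast
    ring
  have hterm : HasSum (fun m : ℤ => (k : ℂ)⁻¹ * ∑ j ∈ Finset.range k, fourierCoeffF F m *
      Complex.exp (Complex.I * m * ((y.arg + 2 * Real.pi * j) / k : ℝ))) (Δroot F k y) := by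
    rw [Δroot]
    simp_rw [hpt]
    exact (hasSum_sum fun j _ => hasSum_fourierCoeffF hF hsum _).mul_left _
  have hbound : ∀ m : ℤ, ‖(k : ℂ)⁻¹ * ∑ j ∈ Finset.range k, fourierCoeffF F m *
      Complex.exp (Complex.I * m * ((y.arg + 2 * Real.pi * j) / k : ℝ))‖ ≤
      if (k : ℤ) ∣ m then ‖fourierCoeffF F m‖ else 0 := by
    intro m
    split_ifs with hm
    · rw [norm_mul, norm_inv, Complex.norm_natCast, inv_mul_le_iff₀ (by positivity)]
      refine (norm_sum_le _ _).trans (le_of_eq ?_)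
      have : ∀ t : ℝ, ‖Complex.exp (Complex.I * m * t)‖ = 1 := by
        intro t
        rw [show Complex.I * m * t = ((m * t : ℝ) : ℂ) * Complex.I by push_cast; ring]
        exact Complex.norm_exp_ofReal_mul_I _
      simp only [norm_mul, this, mul_one, Finset.sum_const, Finset.card_range, nsmul_eq_mul]
    · rw [← Finset.mul_sum]
      have : ∀ j : ℕ, Complex.exp (Complex.I * m * ((y.arg + 2 * Real.pi * j) / k : ℝ)) =
          Complex.exp (Complex.I * m * y.arg / k) *
            Complex.exp (2 * Real.pi * Complex.I * m * j / k) := by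
        intro j
        rw [← Complex.exp_add]
        congr 1
        push_cast
        ring
      simp_rw [this]
      rw [← Finset.mul_sum, sum_range_exp_eq_zero_of_not_dvd hk hm]
      simp
  have hs : Summable fun m : ℤ => if (k : ℤ) ∣ m then ‖fourierCoeffF F m‖ else 0 :=
    hsum.of_nonneg_of_le (fun m => by positivity) fun m => by
      split_ifs
      · exact le_rfl
      · exact norm_nonneg _
  rw [← hterm.tsum_eq]
  exact tsum_of_norm_bounded hs.hasSum hbound

theorem summable_rpow_mul_tsum_dvd {c : ℤ → ℝ} (hc : ∀ m, 0 ≤ c m) (hc0 : c 0 = 0) {a s : ℝ}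
    (ha : 0 ≤ a) (has : a < s) (hsum : Summable fun m : ℤ => |(m : ℝ)| ^ s * c m) :
    Summable fun k : ℕ => (k : ℝ) ^ a * ∑' m : ℤ, if (k : ℤ) ∣ m then c m else 0 := by
  obtain ⟨C, hC, hdiv⟩ := exists_card_divisors_le_mul_rpow (sub_pos.mpr has)
  let g : ℤ × ℕ → ℝ := fun x => (x.2 : ℝ) ^ a * if (x.2 : ℤ) ∣ x.1 then c x.1 else 0
  have hg : 0 ≤ g := fun x => mul_nonneg (by positivity) (by split_ifs; exacts [hc _, le_rfl])
  have hsupp : ∀ m : ℤ, ∀ k ∉ m.natAbs.divisors, g (m, k) = 0 := by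
    intro m k hk
    rcases eq_or_ne m 0 with rfl | hm
    · simp [g, hc0]
    · have : ¬ (k : ℤ) ∣ m := fun h => hk (by simpa [hm] using Int.natCast_dvd.mp h)
      simp [g, this]
  have hgs : Summable g := by
    rw [summable_prod_of_nonneg hg]
    refine ⟨fun m => summable_of_ne_finset_zero (hsupp m), ?_⟩
    refine (hsum.mul_left C).of_nonneg_of_le (fun m => tsum_nonneg fun k => hg _) fun m => ?_
    rw [tsum_eq_sum (hsupp m)]
    rcases eq_or_ne m 0 with rfl | hm
    · simp [hc0]
    have hmabs : ((m.natAbs : ℕ) : ℝ) = |(m : ℝ)| := by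
      rw [Nat.cast_natAbs, Int.cast_abs]
    have hmpos : 0 < |(m : ℝ)| := abs_pos.mpr (by exact_mod_cast hm)
    calc ∑ k ∈ m.natAbs.divisors, g (m, k)
        ≤ ∑ k ∈ m.natAbs.divisors, |(m : ℝ)| ^ a * c m := by
          refine Finset.sum_le_sum fun k hk => ?_
          have hkm : (k : ℝ) ≤ |(m : ℝ)| := by
            rw [← hmabs]
            exact_mod_cast Nat.divisor_le hk
          refine mul_le_mul (by gcongr) ?_ (by split_ifs; exacts [hc _, le_rfl]) (by positivity)
          dsimp only
          split_ifs
          exacts [le_rfl, hc _]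
      _ = (m.natAbs.divisors.card : ℝ) * (|(m : ℝ)| ^ a * c m) := by
          rw [Finset.sum_const, nsmul_eq_mul]
      _ ≤ C * |(m : ℝ)| ^ (s - a) * (|(m : ℝ)| ^ a * c m) := by
          refine mul_le_mul_of_nonneg_right ?_ (mul_nonneg (by positivity) (hc m))
          rw [← hmabs]
          exact hdiv _ (by simpa using hm)
      _ = C * (|(m : ℝ)| ^ s * c m) := by
          have : |(m : ℝ)| ^ s = |(m : ℝ)| ^ (s - a) * |(m : ℝ)| ^ a := by
            rw [← Real.rpow_add hmpos, sub_add_cancel]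
          rw [this]
          ring
  simpa only [g, Prod.swap, tsum_mul_left] using hgs.prod_symm.prod

/-- If `F` is continuous on the unit circle with `c₀(F) = 0` and
`∑_m |m|^s·|c_m(F)| < ∞` for some `s > (1−ϑ)₊`, then
`∑_k k^{(1−ϑ)₊}·sup_x |Δ_k(F,e^{ix})| < ∞`; in particular
`∑_k k^{(1−ϑ)₊}·𝔼[|Δ_k(F,Z_k)|] < ∞` for any circle-valued random variables `Z_k`. -/
theorem fourier_summability_gives_Delta_summability (F : ℂ → ℂ)
    (hF : ContinuousOn F (Metric.sphere (0 : ℂ) 1))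
    (hc0 : fourierCoeffF F 0 = 0)
    (ϑ : ℝ) (hϑ : 0 ≤ ϑ)
    (s : ℝ) (hs : max (1 - ϑ) 0 < s)
    (hsum : Summable fun m : ℤ => |(m : ℝ)| ^ s * ‖fourierCoeffF F m‖) :
    (Summable fun k : ℕ => (k : ℝ) ^ (max (1 - ϑ) 0) *
      ⨆ x : Set.Ico (0 : ℝ) (2 * Real.pi),
        ‖Δroot F k (Complex.exp (Complex.I * (x : ℝ)))‖)
    ∧ ∀ (Ω : Type) [MeasurableSpace Ω] (μ : Measure Ω) [IsProbabilityMeasure μ]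
        (Z : ℕ → Ω → ℂ), (∀ k ω, Z k ω ∈ Metric.sphere (0 : ℂ) 1) →
        Summable fun k : ℕ => (k : ℝ) ^ (max (1 - ϑ) 0) *
          ∫ ω, ‖Δroot F k (Z k ω)‖ ∂μ := by
  have ha : 0 ≤ max (1 - ϑ) 0 := le_max_right _ _
  have hsum' := summable_norm_fourierCoeffF (ha.trans hs.le) hsum
  have hmain := summable_rpow_mul_tsum_dvd (fun m => norm_nonneg (fourierCoeffF F m))
    (by rw [hc0, norm_zero]) ha hs hsum
  have hbound : ∀ (k : ℕ) (y : ℂ), y ∈ Metric.sphere (0 : ℂ) 1 →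
      ‖Δroot F k y‖ ≤ ∑' m : ℤ, if (k : ℤ) ∣ m then ‖fourierCoeffF F m‖ else 0 := by
    intro k y hy
    rcases eq_or_ne k 0 with rfl | hk
    · simp [Δroot]
    · exact norm_Δroot_le hF hsum' hk hy
  refine ⟨hmain.of_nonneg_of_le (fun k => ?_) (fun k => ?_), fun Ω _ μ _ Z hZ =>
    hmain.of_nonneg_of_le (fun k => by positivity) (fun k => ?_)⟩
  · exact mul_nonneg (by positivity) (Real.iSup_nonneg fun _ => norm_nonneg _)
  · refine mul_le_mul_of_nonneg_left (Real.iSup_le (fun x => hbound k _ ?_) ?_) (by positivity)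
    · rw [mem_sphere_zero_iff_norm, mul_comm]
      exact Complex.norm_exp_ofReal_mul_I _
    · exact tsum_nonneg fun m => by positivity
  · refine mul_le_mul_of_nonneg_left ?_ (by positivity)
    refine (integral_mono_of_nonneg (Eventually.of_forall fun ω => norm_nonneg _)
      (integrable_const _) (Eventually.of_forall fun ω => hbound k _ (hZ k ω))).trans_eq ?_
    simp
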